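/- Let n be a nonnegative integer. There exists a square-free circular word of length n over the alphabet {0, 1, 2} if and only if n ∉ {5, 7, 9, 10, 14, 17}. -/

import Mathlib

/-- A word `w` is square-free if it contains no factor `x ++ x` with `x` nonempty. -/
def SquareFree {α : Type*} (w : List α) : Prop :=
  ∀ x : List α, x ≠ [] → ¬ (x ++ x) <:+: w

/-- `v` is an extension of `w`: insert a single letter anywhere in `w`. -/
def IsExtension {α : Type*} (w v : List α) : Prop :=
  ∃ (w' w'' : List α) (a : α), w = w' ++ w'' ∧ v = w' ++ [a] ++ w''

/-- `w` is extremal square-free. -/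
def ExtremalSquareFree {α : Type*} (w : List α) : Prop :=
  SquareFree w ∧ ∀ v, IsExtension w v → ¬ SquareFree v

/-- The circular word `⟨w⟩` is square-free: every conjugate (rotation) of `w` is square-free. -/
def CircSquareFree {α : Type*} (w : List α) : Prop :=
  ∀ u : List α, u ~r w → SquareFree u

/-- The circular word `⟨w⟩` is extremal square-free. -/
def ExtremalCircSquareFree {α : Type*} (w : List α) : Prop :=
  CircSquareFree w ∧
    ∀ (w' w'' : List α) (a : α), w = w' ++ w'' → ¬ CircSquareFree (w' ++ [a] ++ w'')

/-! ### Squares at the beginning of a word, and circular words -/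

theorem SquareFree.of_infix {α : Type*} {v w : List α} (hw : SquareFree w) (h : v <:+: w) :
    SquareFree v :=
  fun x hx hi => hw x hx (hi.trans h)

theorem circSquareFree_iff_prefix {α : Type*} {w : List α} :
    CircSquareFree w ↔ ∀ v, v ~r w → ∀ x, x ≠ [] → ¬ x ++ x <+: v := by
  constructor
  · exact fun h v hv x hx hp => h v hv x hx hp.isInfix
  · rintro h u hu x hx ⟨s, t, rfl⟩
    refine h (x ++ x ++ t ++ s) (List.IsRotated.trans ?_ hu) x hx (by simp [List.append_assoc])
    simpa [List.append_assoc] using List.isRotated_append (l := x ++ x ++ t) (l' := s)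

theorem circSquareFree_iff_rotate {α : Type*} {w : List α} (hw : w ≠ []) :
    CircSquareFree w ↔ ∀ k < w.length, ∀ x, x ≠ [] → ¬ x ++ x <+: w.rotate k := by
  rw [circSquareFree_iff_prefix]
  constructor
  · exact fun h k _ => h _ (List.IsRotated.symm ⟨k, rfl⟩)
  · rintro h v hv
    obtain ⟨n, rfl⟩ := hv.symm
    rw [← List.rotate_mod]
    exact h _ (Nat.mod_lt _ (List.length_pos_iff.2 hw))

/-- Repeating the first letter of a circular square-free word at its end creates no square. -/
theorem CircSquareFree.squareFree_concat_head {α : Type*} {a : α} {z : List α} (hz : z ≠ [])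
    (h : CircSquareFree (a :: z)) : SquareFree (a :: z ++ [a]) := by
  have h₁ : SquareFree (a :: z) := h _ (List.IsRotated.refl _)
  have h₂ : SquareFree (z ++ [a]) := h _ (by simpa using List.isRotated_append (l := z) (l' := [a]))
  rintro x hx ⟨s, t, hst⟩
  rcases List.eq_nil_or_concat t with rfl | ⟨t, b, rfl⟩
  · rcases s with _ | ⟨b, s⟩
    · obtain _ | ⟨b, x⟩ := x
      · exact hx rfl
      simp only [List.nil_append, List.append_nil, List.cons_append, List.cons.injEq] at hst
      obtain ⟨rfl, hst⟩ := hst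
      rcases List.eq_nil_or_concat x with rfl | ⟨x, c, rfl⟩
      · simp_all
      · have hst : (x ++ c :: b :: x) ++ [c] = z ++ [b] := by simpa using hst
        obtain ⟨rfl, hc⟩ := List.append_inj' hst rfl
        obtain rfl : c = b := by simpa using hc
        exact h₁ [c] (by simp) ⟨c :: x, x, by simp⟩
    · refine h₂ x hx ⟨s, [], ?_⟩
      simpa using (List.cons.inj hst).2
  · refine h₁ x hx ⟨s, t, ?_⟩
    have : (s ++ (x ++ x) ++ t) ++ [b] = (a :: z) ++ [a] := by simpa using hst
    exact (List.append_inj' this rfl).1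

/-! ### Checking squares arithmetically -/

/-- The number whose base `4` digits, the least significant first, form the given word. -/
def code : List (Fin 3) → ℕ
  | [] => 0
  | a :: l => a.val + 4 * code l

theorem code_injective_of_length_eq : ∀ {l l' : List (Fin 3)}, l.length = l'.length →
    code l = code l' → l = l'
  | [], [], _, _ => rfl
  | a :: l, b :: l', hl, h => by
    simp only [code] at h
    have ha := a.isLt
    have hb := b.isLt
    rw [code_injective_of_length_eq (l := l) (l' := l') (by simpa using hl) (by omega),
      Fin.ext (show a.val = b.val by omega)]

theorem code_drop (p : ℕ) (l : List (Fin 3)) : code (l.drop p) = code l / 4 ^ p := by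
  induction p generalizing l with
  | zero => simp
  | succ p ih =>
    cases l with
    | nil => simp [code]
    | cons a l =>
      have ha := a.isLt
      rw [List.drop_succ_cons, ih, pow_succ', ← Nat.div_div_eq_div_mul, code,
        show (a.val + 4 * code l) / 4 = code l by omega]

theorem code_take (p : ℕ) (l : List (Fin 3)) : code (l.take p) = code l % 4 ^ p := by
  induction p generalizing l with
  | zero => simp [code, Nat.mod_one]
  | succ p ih =>
    cases l with
    | nil => simp [code]
    | cons a l =>
      have ha := a.isLt
      rw [List.take_succ_cons, code, code, ih, pow_succ', Nat.mod_mul,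
        show (a.val + 4 * code l) / 4 = code l by omega,
        show (a.val + 4 * code l) % 4 = a.val by omega]

theorem code_append (l l' : List (Fin 3)) : code (l ++ l') = code l + code l' * 4 ^ l.length := by
  induction l with
  | nil => simp [code]
  | cons a l ih => simp only [List.cons_append, code, ih, List.length_cons]; ring

/-- Does a word with code `c` begin with a square of period at most `k`? -/
def squarePrefixCode (c k : ℕ) : Bool :=
  k.rec false fun p b => (Nat.beq (Nat.mod c (Nat.pow 4 p.succ))
    (Nat.mod (Nat.div c (Nat.pow 4 p.succ)) (Nat.pow 4 p.succ))).or b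

theorem squarePrefixCode_succ (c k : ℕ) : squarePrefixCode c (k + 1) =
    (Nat.beq (c % 4 ^ (k + 1)) (c / 4 ^ (k + 1) % 4 ^ (k + 1)) || squarePrefixCode c k) :=
  rfl

theorem squarePrefixCode_eq_true_iff {c k : ℕ} : squarePrefixCode c k = true ↔
    ∃ p, 0 < p ∧ p ≤ k ∧ c % 4 ^ p = c / 4 ^ p % 4 ^ p := by
  induction k with
  | zero => simp [squarePrefixCode]
  | succ k ih =>
    simp only [squarePrefixCode_succ, Bool.or_eq_true, ih, Nat.beq_eq]
    constructor
    · rintro (h | ⟨p, h0, hp, h⟩)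
      · exact ⟨k + 1, by omega, le_rfl, h⟩
      · exact ⟨p, h0, by omega, h⟩
    · rintro ⟨p, h0, hp, h⟩
      rcases hp.eq_or_lt with rfl | hp
      · exact Or.inl h
      · exact Or.inr ⟨p, h0, by omega, h⟩

theorem squarePrefixCode_of_prefix {w x : List (Fin 3)} {k : ℕ} (hx : x ≠ []) (hk : x.length ≤ k)
    (h : x ++ x <+: w) : squarePrefixCode (code w) k = true := by
  obtain ⟨t, rfl⟩ := h
  refine squarePrefixCode_eq_true_iff.2 ⟨x.length, List.length_pos_iff.2 hx, hk, ?_⟩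
  rw [← code_take, ← code_drop, ← code_take]
  simp [List.append_assoc]

theorem exists_prefix_of_squarePrefixCode {w : List (Fin 3)} {k : ℕ} (hk : 2 * k ≤ w.length)
    (h : squarePrefixCode (code w) k = true) :
    ∃ x, x ≠ [] ∧ x.length ≤ k ∧ x ++ x <+: w := by
  obtain ⟨p, h0, hp, h⟩ := squarePrefixCode_eq_true_iff.1 h
  rw [← code_take, ← code_drop, ← code_take] at h
  have h := code_injective_of_length_eq (by simp; omega) h
  refine ⟨w.take p, ?_, by simp; omega, ?_⟩
  · rw [← List.length_pos_iff, List.length_take]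
    omega
  · nth_rewrite 2 [h]
    rw [← List.take_add]
    exact List.take_prefix _ _

/-- Is the circular word formed from the word of length `n` with code `c` square-free? -/
def isCircSquareFreeCode (n c : ℕ) : Bool :=
  (List.range n).all fun k => !squarePrefixCode ((c + c * 4 ^ n) / 4 ^ k) (n / 2)

theorem rotate_prefix_drop_append_self {α : Type*} {w : List α} {k : ℕ} (hk : k ≤ w.length) :
    w.rotate k <+: (w ++ w).drop k := by
  rw [List.rotate_eq_drop_append_take hk, List.drop_append_of_le_length hk,
    List.prefix_append_right_inj]
  exact List.take_prefix _ _

theorem isCircSquareFreeCode_iff {w : List (Fin 3)} :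
    isCircSquareFreeCode w.length (code w) = true ↔ CircSquareFree w := by
  rcases eq_or_ne w [] with rfl | hw
  · simp only [isCircSquareFreeCode, circSquareFree_iff_prefix]
    simp +contextual
  rw [circSquareFree_iff_rotate hw]
  simp only [isCircSquareFreeCode, List.all_eq_true, List.mem_range, Bool.not_eq_true',
    ← Bool.not_eq_true, ← code_append, ← code_drop]
  refine forall₂_congr fun k hk => ?_
  have hrot := rotate_prefix_drop_append_self hk.le
  constructor
  · intro h x hx hp
    refine h (squarePrefixCode_of_prefix hx ?_ (hp.trans hrot))
    have := hp.length_le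
    simp only [List.length_append, List.length_rotate] at this
    omega
  · intro h hs
    obtain ⟨x, hx, hxk, hp⟩ := exists_prefix_of_squarePrefixCode (by simp; omega) hs
    refine h x hx (List.prefix_of_prefix_length_le hp hrot ?_)
    simp only [List.length_append, List.length_rotate]
    omega

/-! ### Lengths admitting no circular square-free word -/

/-- Does every way of writing `m` letters in front of a word with code `c`, so as to reach the
length `n`, fail to give a circular square-free word? Branches that already contain a square are
abandoned. -/
def noExtension (n : ℕ) : ℕ → ℕ → Bool
  | 0, c => !isCircSquareFreeCode n c
  | m + 1, c => [0, 1, 2].all fun a =>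
      squarePrefixCode (a + 4 * c) ((n - m) / 2) || noExtension n m (a + 4 * c)

theorem not_circSquareFree_of_noExtension {n m : ℕ} {v w : List (Fin 3)}
    (h : noExtension n m (code w) = true) (hv : v.length = m) (hn : (v ++ w).length = n) :
    ¬ CircSquareFree (v ++ w) := by
  induction m generalizing v w with
  | zero =>
    obtain rfl := List.length_eq_zero_iff.1 hv
    subst hn
    rw [← isCircSquareFreeCode_iff]
    simpa [noExtension] using h
  | succ m ih =>
    rcases List.eq_nil_or_concat v with rfl | ⟨v, a, rfl⟩
    · simp at hv
    simp only [List.length_append, List.length_concat] at hv hn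
    intro hc
    have ha : squarePrefixCode (code (a :: w)) ((n - m) / 2) = true ∨
        noExtension n m (code (a :: w)) = true := by
      rw [noExtension, List.all_eq_true] at h
      simpa [code] using h a.val (by fin_cases a <;> simp)
    rcases ha with ha | ha
    · obtain ⟨x, hx, -, hp⟩ := exists_prefix_of_squarePrefixCode (by simp; omega) ha
      exact hc _ (List.IsRotated.refl _) x hx (hp.isInfix.trans ⟨v, [], by simp⟩)
    · exact ih ha (v := v) (by omega) (by simp; omega) (by simpa using hc)

theorem noExtension_exceptional : ∀ n ∈ [5, 7, 9, 10, 14, 17], noExtension n n 0 = true := by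
  decide +kernel

/-! ### Short circular square-free words -/

/-- Circular square-free words of various small lengths. -/
def smallWords : List (List (Fin 3)) := [
  [0],
  [0, 2],
  [0, 2, 1],
  [0, 2, 0, 1],
  [0, 2, 0, 1, 2, 1],
  [0, 2, 0, 1, 2, 0, 2, 1],
  [0, 2, 0, 1, 0, 2, 1, 2, 0, 2, 1],
  [0, 2, 0, 1, 0, 2, 1, 2, 0, 1, 2, 1],
  [0, 2, 0, 1, 0, 2, 1, 0, 1, 2, 0, 2, 1],
  [0, 2, 0, 1, 0, 2, 1, 2, 0, 2, 1, 0, 1, 2, 1],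
  [0, 2, 0, 1, 0, 2, 1, 2, 0, 1, 0, 2, 0, 1, 2, 1],
  [0, 2, 0, 1, 0, 2, 1, 2, 0, 1, 2, 1, 0, 1, 2, 0, 2, 1],
  [0, 2, 0, 1, 0, 2, 1, 2, 0, 1, 2, 1, 0, 2, 1, 2, 0, 2, 1],
  [0, 2, 0, 1, 0, 2, 1, 2, 0, 1, 2, 1, 0, 2, 0, 1, 2, 0, 2, 1],
  [0, 2, 0, 1, 2, 1, 0, 2, 1, 2, 0, 1, 0, 2, 1, 0, 1, 2, 0, 2, 1],
  [0, 2, 0, 1, 0, 2, 1, 2, 0, 1, 2, 1, 0, 1, 2, 0, 2, 1, 0, 1, 2, 1],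
  [0, 2, 0, 1, 0, 2, 1, 2, 0, 1, 2, 1, 0, 2, 1, 2, 0, 2, 1, 0, 1, 2, 1],
  [0, 2, 0, 1, 0, 2, 1, 2, 0, 1, 2, 1, 0, 2, 0, 1, 2, 0, 2, 1, 0, 1, 2, 1],
  [0, 2, 0, 1, 0, 2, 1, 2, 0, 1, 2, 1, 0, 2, 0, 1, 0, 2, 1, 0, 1, 2, 0, 2, 1],
  [0, 2, 0, 1, 0, 2, 1, 2, 0, 1, 2, 1, 0, 2, 1, 2, 0, 1, 0, 2, 0, 1, 2, 0, 2, 1],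
  [0, 2, 0, 1, 0, 2, 1, 2, 0, 1, 2, 1, 0, 2, 1, 2, 0, 1, 0, 2, 1, 0, 1, 2, 0, 2, 1],
  [0, 2, 0, 1, 0, 2, 1, 2, 0, 1, 2, 1, 0, 1, 2, 0, 1, 0, 2, 1, 2, 0, 2, 1, 0, 1, 2, 1],
  [0, 2, 0, 1, 0, 2, 1, 2, 0, 1, 2, 1, 0, 2, 0, 1, 2, 0, 2, 1, 2, 0, 1, 0, 2, 0, 1, 2, 1],
  [0, 2, 0, 1, 0, 2, 1, 2, 0, 1, 2, 1, 0, 2, 0, 1, 0, 2, 1, 0, 1, 2, 1, 0, 2, 1, 2, 0, 2, 1],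
  [0, 2, 0, 1, 0, 2, 1, 2, 0, 1, 2, 1, 0, 2, 0, 1, 0, 2, 1, 0, 1, 2, 0, 1, 0, 2, 1, 2, 0, 2, 1],
  [0, 2, 0, 1, 0, 2, 1, 2, 0, 1, 2, 1, 0, 2, 0, 1, 0, 2, 1, 0, 1, 2, 0, 1, 0, 2, 0, 1, 2, 0, 2,
    1],
  [0, 2, 0, 1, 0, 2, 1, 2, 0, 1, 2, 1, 0, 2, 0, 1, 2, 0, 2, 1, 0, 1, 2, 0, 1, 0, 2, 0, 1, 2, 0,
    2, 1],
  [0, 2, 0, 1, 0, 2, 1, 2, 0, 1, 2, 1, 0, 2, 0, 1, 0, 2, 1, 2, 0, 2, 1, 0, 1, 2, 0, 1, 0, 2, 1,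
    0, 1, 2, 0, 2, 1],
  [0, 2, 0, 1, 0, 2, 1, 2, 0, 1, 2, 1, 0, 2, 0, 1, 0, 2, 1, 0, 1, 2, 1, 0, 2, 1, 2, 0, 1, 0, 2,
    1, 0, 1, 2, 0, 2, 1],
  [0, 2, 0, 1, 0, 2, 1, 2, 0, 1, 2, 1, 0, 2, 0, 1, 0, 2, 1, 2, 0, 2, 1, 0, 1, 2, 0, 2, 1, 2, 0,
    1, 0, 2, 1, 2, 0, 2, 1],
  [0, 2, 0, 1, 0, 2, 1, 2, 0, 1, 2, 1, 0, 2, 0, 1, 0, 2, 1, 2, 0, 2, 1, 0, 1, 2, 0, 1, 0, 2, 1,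
    0, 1, 2, 1, 0, 2, 0, 1, 2, 0, 2, 1],
  [0, 2, 0, 1, 0, 2, 1, 2, 0, 1, 2, 1, 0, 2, 0, 1, 0, 2, 1, 2, 0, 2, 1, 0, 1, 2, 0, 2, 1, 2, 0,
    1, 0, 2, 0, 1, 2, 1, 0, 1, 2, 0, 2, 1],
  [0, 2, 0, 1, 0, 2, 1, 2, 0, 1, 2, 1, 0, 2, 0, 1, 0, 2, 1, 2, 0, 2, 1, 0, 2, 0, 1, 2, 1, 0, 1,
    2, 0, 2, 1, 2, 0, 1, 0, 2, 1, 2, 0, 2, 1],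
  [0, 2, 0, 1, 0, 2, 1, 2, 0, 1, 2, 1, 0, 2, 0, 1, 0, 2, 1, 2, 0, 2, 1, 0, 1, 2, 1, 0, 2, 0, 1,
    0, 2, 1, 2, 0, 1, 0, 2, 0, 1, 2, 1, 0, 1, 2, 0, 2, 1],
  [0, 2, 0, 1, 0, 2, 1, 2, 0, 1, 2, 1, 0, 2, 0, 1, 0, 2, 1, 2, 0, 2, 1, 0, 2, 0, 1, 0, 2, 1, 0,
    1, 2, 0, 1, 0, 2, 1, 2, 0, 1, 2, 1, 0, 2, 1, 2, 0, 2, 1],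
  [0, 2, 0, 1, 0, 2, 1, 2, 0, 1, 2, 1, 0, 2, 0, 1, 0, 2, 1, 2, 0, 2, 1, 0, 2, 0, 1, 2, 0, 2, 1,
    2, 0, 1, 0, 2, 0, 1, 2, 0, 2, 1, 0, 2, 0, 1, 2, 1, 0, 2, 1, 2, 0, 2, 1],
  [0, 2, 0, 1, 0, 2, 1, 2, 0, 1, 2, 1, 0, 2, 0, 1, 0, 2, 1, 2, 0, 2, 1, 0, 2, 0, 1, 0, 2, 1, 0,
    1, 2, 0, 2, 1, 0, 2, 0, 1, 2, 0, 2, 1, 0, 1, 2, 0, 1, 0, 2, 1, 2, 0, 2, 1],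
  [0, 2, 0, 1, 0, 2, 1, 2, 0, 1, 2, 1, 0, 2, 0, 1, 0, 2, 1, 2, 0, 2, 1, 0, 1, 2, 1, 0, 2, 0, 1,
    2, 0, 2, 1, 2, 0, 1, 0, 2, 1, 0, 1, 2, 1, 0, 2, 1, 2, 0, 1, 2, 1, 0, 2, 0, 1, 2, 0, 2, 1],
  [1, 2, 0, 2, 1, 2, 0, 1, 0, 2, 1, 2, 0, 2, 1, 0, 1, 2, 1, 0, 2, 0, 1, 0, 2, 1, 0, 1, 2, 0, 1,
    0, 2, 0, 1, 2, 1, 0, 2, 0, 1, 0, 2, 1, 2, 0, 1, 0, 2, 0, 1, 2, 1, 0, 2, 1, 2, 0, 1, 2, 1, 0],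
  [1, 2, 0, 2, 1, 2, 0, 1, 0, 2, 1, 2, 0, 2, 1, 0, 1, 2, 1, 0, 2, 0, 1, 0, 2, 1, 0, 1, 2, 0, 1,
    0, 2, 0, 1, 2, 1, 0, 2, 0, 1, 0, 2, 1, 2, 0, 1, 0, 2, 0, 1, 2, 1, 0, 2, 1, 2, 0, 2, 1, 0, 1,
    2, 1, 0, 2, 0],
  [1, 2, 0, 2, 1, 2, 0, 1, 0, 2, 1, 2, 0, 2, 1, 0, 1, 2, 1, 0, 2, 0, 1, 0, 2, 1, 0, 1, 2, 0, 1,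
    0, 2, 0, 1, 2, 1, 0, 2, 0, 1, 0, 2, 1, 2, 0, 1, 0, 2, 0, 1, 2, 1, 0, 2, 1, 2, 0, 2, 1, 0, 1,
    2, 1, 0, 2, 1, 2, 0, 1, 0, 2, 0],
  [1, 2, 0, 2, 1, 2, 0, 1, 0, 2, 1, 2, 0, 2, 1, 0, 1, 2, 1, 0, 2, 0, 1, 0, 2, 1, 0, 1, 2, 0, 1,
    0, 2, 0, 1, 2, 1, 0, 2, 0, 1, 0, 2, 1, 2, 0, 1, 0, 2, 0, 1, 2, 1, 0, 2, 1, 2, 0, 2, 1, 0, 1,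
    2, 1, 0, 2, 0, 1, 2, 1, 0, 1, 2, 0, 1, 0, 2, 1, 0],
  [1, 2, 0, 2, 1, 2, 0, 1, 0, 2, 1, 2, 0, 2, 1, 0, 1, 2, 1, 0, 2, 0, 1, 0, 2, 1, 0, 1, 2, 0, 1,
    0, 2, 0, 1, 2, 1, 0, 2, 0, 1, 0, 2, 1, 2, 0, 1, 0, 2, 0, 1, 2, 1, 0, 2, 1, 2, 0, 2, 1, 0, 1,
    2, 1, 0, 2, 0, 1, 2, 1, 0, 1, 2, 0, 1, 0, 2, 1, 0, 1, 2, 1, 0, 2, 0],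
  [1, 2, 0, 2, 1, 2, 0, 1, 0, 2, 1, 2, 0, 2, 1, 0, 1, 2, 1, 0, 2, 0, 1, 0, 2, 1, 0, 1, 2, 0, 1,
    0, 2, 0, 1, 2, 1, 0, 2, 0, 1, 0, 2, 1, 2, 0, 1, 0, 2, 0, 1, 2, 1, 0, 2, 1, 2, 0, 2, 1, 0, 1,
    2, 1, 0, 2, 0, 1, 2, 1, 0, 1, 2, 0, 1, 0, 2, 0, 1, 2, 0, 2, 1, 0, 2, 0, 1, 0, 2, 1, 0],
  [1, 2, 0, 2, 1, 2, 0, 1, 0, 2, 1, 2, 0, 2, 1, 0, 1, 2, 1, 0, 2, 0, 1, 0, 2, 1, 0, 1, 2, 0, 1,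
    0, 2, 0, 1, 2, 1, 0, 2, 0, 1, 0, 2, 1, 2, 0, 1, 0, 2, 0, 1, 2, 1, 0, 2, 1, 2, 0, 2, 1, 0, 1,
    2, 1, 0, 2, 0, 1, 2, 1, 0, 1, 2, 0, 1, 0, 2, 0, 1, 2, 0, 2, 1, 0, 1, 2, 1, 0, 2, 1, 2, 0, 2,
    1, 0, 2, 0],
  [1, 2, 0, 2, 1, 2, 0, 1, 0, 2, 1, 2, 0, 2, 1, 0, 1, 2, 1, 0, 2, 0, 1, 0, 2, 1, 0, 1, 2, 0, 1,
    0, 2, 0, 1, 2, 1, 0, 2, 0, 1, 0, 2, 1, 2, 0, 1, 0, 2, 0, 1, 2, 1, 0, 2, 1, 2, 0, 2, 1, 0, 1,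
    2, 1, 0, 2, 0, 1, 2, 1, 0, 1, 2, 0, 1, 0, 2, 0, 1, 2, 0, 2, 1, 0, 1, 2, 1, 0, 2, 1, 2, 0, 1,
    2, 1, 0, 2, 0],
  [1, 2, 0, 2, 1, 2, 0, 1, 0, 2, 1, 2, 0, 2, 1, 0, 1, 2, 1, 0, 2, 0, 1, 0, 2, 1, 0, 1, 2, 0, 1,
    0, 2, 0, 1, 2, 1, 0, 2, 0, 1, 0, 2, 1, 2, 0, 1, 0, 2, 0, 1, 2, 1, 0, 2, 1, 2, 0, 2, 1, 0, 1,
    2, 1, 0, 2, 0, 1, 2, 1, 0, 1, 2, 0, 1, 0, 2, 0, 1, 2, 0, 2, 1, 0, 1, 2, 1, 0, 2, 0, 1, 0, 2,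
    1, 2, 0, 2, 1, 0],
  [1, 2, 0, 2, 1, 2, 0, 1, 0, 2, 1, 2, 0, 2, 1, 0, 1, 2, 1, 0, 2, 0, 1, 0, 2, 1, 0, 1, 2, 0, 1,
    0, 2, 0, 1, 2, 1, 0, 2, 0, 1, 0, 2, 1, 2, 0, 1, 0, 2, 0, 1, 2, 1, 0, 2, 1, 2, 0, 2, 1, 0, 1,
    2, 1, 0, 2, 0, 1, 2, 1, 0, 1, 2, 0, 1, 0, 2, 0, 1, 2, 0, 2, 1, 0, 1, 2, 1, 0, 2, 0, 1, 0, 2,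
    1, 2, 0, 1, 0, 2, 0],
  [1, 2, 0, 2, 1, 2, 0, 1, 0, 2, 1, 2, 0, 2, 1, 0, 1, 2, 1, 0, 2, 0, 1, 0, 2, 1, 0, 1, 2, 0, 1,
    0, 2, 0, 1, 2, 1, 0, 2, 0, 1, 0, 2, 1, 2, 0, 1, 0, 2, 0, 1, 2, 1, 0, 2, 1, 2, 0, 2, 1, 0, 1,
    2, 1, 0, 2, 0, 1, 2, 1, 0, 1, 2, 0, 1, 0, 2, 0, 1, 2, 0, 2, 1, 0, 1, 2, 1, 0, 2, 0, 1, 0, 2,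
    1, 2, 0, 2, 1, 0, 2, 0],
  []]

theorem circSquareFree_of_mem_smallWords {w : List (Fin 3)} (hw : w ∈ smallWords) :
    CircSquareFree w := by
  have h : ∀ w ∈ smallWords, isCircSquareFreeCode w.length (code w) = true := by decide +kernel
  exact isCircSquareFreeCode_iff.1 (h w hw)

theorem small_lengths : ∀ n < 102, n ∉ [5, 7, 9, 10, 14, 17] →
    (∃ w ∈ smallWords, w.length = n) ∨
      ∃ m ∈ [2, 3, 4], ∃ r ≤ m, ∃ s ≤ m, n = 17 * m + r + 6 * s := by
  decide +kernel

/-! ### A substitution with images of several lengths -/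

/-- A letter together with the choice of one of its four images. -/
abbrev Choice := Fin 3 × Bool × Bool

/-- The chosen image of a letter; its length is `17`, increased by `1` and by `6` according to the
two flags. -/
def image : Choice → List (Fin 3)
  | (a, r, s) => List.map (a + ·) <|
    match r, s with
    | false, false => [0, 1, 2, 0, 2, 1, 2, 0, 1, 0, 2, 1, 2, 0, 2, 1, 0]
    | true, false => [0, 1, 2, 0, 2, 1, 0, 2, 0, 1, 0, 2, 1, 2, 0, 2, 1, 0]
    | false, true => [0, 1, 2, 0, 2, 1, 2, 0, 1, 2, 1, 0, 2, 0, 1, 0, 2, 1, 2, 0, 2, 1, 0]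
    | true, true => [0, 1, 2, 0, 2, 1, 2, 0, 1, 0, 2, 1, 0, 1, 2, 1, 0, 2, 1, 2, 0, 2, 1, 0]

/-- The concatenation of the chosen images. -/
def images (v : List Choice) : List (Fin 3) := v.flatMap image

/-- The list of all choices. -/
def choices : List Choice := [0, 1, 2].flatMap fun a =>
  [(a, false, false), (a, true, false), (a, false, true), (a, true, true)]

theorem mem_choices (c : Choice) : c ∈ choices := by
  revert c; decide

/-- The length of the longest common prefix of two words. -/
def commonPrefix {α : Type*} [DecidableEq α] : List α → List α → ℕ
  | a :: l, b :: l' => if a = b then commonPrefix l l' + 1 else 0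
  | _, _ => 0

theorem length_image (c : Choice) :
    (image c).length = 17 + c.2.1.toNat + 6 * c.2.2.toNat := by
  revert c; decide

theorem image_prefix_image : ∀ c d : Choice, image c <+: image d → c = d := by
  decide +kernel

theorem getLast?_image : ∀ c : Choice, (image c).getLast? = some c.1 := by
  decide +kernel

/-- No image boundary can be mistaken for an interior point of an image. -/
theorem commonPrefix_interior : ∀ c ∈ choices, ∀ k < (image c).length - 1,
    (choices.map fun a =>
      commonPrefix (image a).reverse ((image c).take (k + 1)).reverse).foldr max 0 +
    (choices.map fun d => if c.1 = d.1 then 0 else (choices.map fun b =>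
      commonPrefix (image b) ((image c).drop (k + 1) ++ image d)).foldr max 0).foldr max 0 < 16 := by
  decide +kernel

theorem no_short_square : ∀ e ∈ choices, ∀ c ∈ choices, e.1 ≠ c.1 → ∀ d ∈ choices, c.1 ≠ d.1 →
    ∀ k < (image e).length,
      squarePrefixCode (code (image e ++ (image c ++ image d)) / 4 ^ k) 15 = false := by
  decide +kernel

theorem image_ne_nil (c : Choice) : image c ≠ [] := by
  rw [← List.length_pos_iff, length_image]
  omega

@[simp]
theorem images_nil : images [] = [] :=
  rfl

@[simp]
theorem images_cons (c : Choice) (v : List Choice) : images (c :: v) = image c ++ images v := by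
  simp [images]

@[simp]
theorem images_append (v w : List Choice) : images (v ++ w) = images v ++ images w := by
  simp [images]

theorem length_le_commonPrefix {α : Type*} [DecidableEq α] {x l l' : List α} (h : x <+: l)
    (h' : x <+: l') : x.length ≤ commonPrefix l l' := by
  obtain ⟨t, rfl⟩ := h
  obtain ⟨t', rfl⟩ := h'
  induction x with
  | nil => simp
  | cons a x ih => simpa [commonPrefix] using ih

theorem le_foldr_max_map {β : Type*} (f : β → ℕ) {l : List β} {b : β} (hb : b ∈ l) :
    f b ≤ (l.map f).foldr max 0 := by
  induction l with
  | nil => simp at hb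
  | cons c l ih =>
    simp only [List.map_cons, List.foldr_cons, le_max_iff]
    rcases List.mem_cons.1 hb with rfl | hb
    · exact Or.inl le_rfl
    · exact Or.inr (ih hb)

/-- A factor of length at least `16` that contains an image boundary does not occur with this
boundary in the interior of an image. -/
theorem not_prefix_of_boundary {a b c d : Choice} {S R Q z z' : List (Fin 3)} (hS : S ≠ [])
    (hSR : 16 ≤ S.length + R.length) (ha : S <:+ image a) (hb : R <+: image b ++ z)
    (hc : Q <:+ image c) (hlt : S.length < Q.length) (hcd : c.1 ≠ d.1) :
    ¬ S ++ R <+: Q ++ (image d ++ z') := by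
  intro h
  obtain ⟨T, rfl⟩ : S <+: Q :=
    List.prefix_of_prefix_length_le ((List.prefix_append S R).trans h) (List.prefix_append _ _)
      hlt.le
  obtain ⟨X, hX⟩ := hc
  rw [List.append_assoc, List.prefix_append_right_inj, ← List.append_assoc] at h
  have hS0 := List.length_pos_iff.2 hS
  have hlen : (image c).length = X.length + S.length + T.length := by
    simp [← hX, Nat.add_assoc]
  simp only [List.length_append] at hlt
  have key := commonPrefix_interior c (mem_choices c) (X.length + S.length - 1) (by omega)
  rw [show X.length + S.length - 1 + 1 = (X ++ S).length by simp; omega, ← hX, ← List.append_assoc,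
    List.take_left, List.drop_left] at key
  have h₁ := le_foldr_max_map (fun a => commonPrefix (image a).reverse (X ++ S).reverse)
    (mem_choices a)
  have h₂ := le_foldr_max_map (fun d => if c.1 = d.1 then 0 else (choices.map fun b =>
    commonPrefix (image b) (T ++ image d)).foldr max 0) (mem_choices d)
  have h₃ := le_foldr_max_map (fun b => commonPrefix (image b) (T ++ image d)) (mem_choices b)
  have h₄ := length_le_commonPrefix (List.reverse_prefix.2 ha)
    (List.reverse_prefix.2 (List.suffix_append X S))
  have hbl := length_image b
  have hdl := length_image d
  have h₅ : (R.take 16).length ≤ commonPrefix (image b) (T ++ image d) := by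
    refine length_le_commonPrefix
      (List.prefix_of_prefix_length_le ((List.take_prefix _ _).trans hb) (List.prefix_append _ _) ?_)
      (List.prefix_of_prefix_length_le ((List.take_prefix _ _).trans h) (List.prefix_append _ _) ?_)
    · rw [List.length_take]
      omega
    · rw [List.length_take, List.length_append]
      omega
  rw [if_neg hcd] at h₂
  simp only [List.length_reverse, List.length_take] at h₄ h₅
  omega

theorem append_eq_append_cases {α : Type*} {S l u t : List α} (h : S ++ l = u ++ t) :
    (∃ Q, Q ≠ [] ∧ S = u ++ Q ∧ t = Q ++ l) ∨ ∃ u', u = S ++ u' ∧ l = u' ++ t := by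
  rcases List.append_eq_append_iff.1 h with h | ⟨Q, rfl, rfl⟩
  · exact Or.inr h
  · rcases eq_or_ne Q [] with rfl | hQ
    · exact Or.inr ⟨[], by simp, by simp⟩
    · exact Or.inl ⟨Q, hQ, rfl, rfl⟩

/-- Cutting a concatenation of images after a proper prefix `u`. -/
theorem exists_cut {u t : List (Fin 3)} {r : List Choice} (h : images r = u ++ t) (ht : t ≠ []) :
    ∃ x c r' P Q, r = x ++ c :: r' ∧ u = images x ++ P ∧ image c = P ++ Q ∧ Q ≠ [] ∧
      t = Q ++ images r' := by
  induction r generalizing u with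
  | nil => simp_all
  | cons c r ih =>
    rw [images_cons] at h
    rcases append_eq_append_cases h with ⟨Q, hQ, hc, rfl⟩ | ⟨u', rfl, h'⟩
    · exact ⟨[], c, r, u, Q, rfl, rfl, hc, hQ, rfl⟩
    · obtain ⟨x, d, r', P, Q, rfl, rfl, hd, hQ, rfl⟩ := ih h'
      exact ⟨c :: x, d, r', P, Q, rfl, by simp, hd, hQ, rfl⟩

/-- The images form a prefix code. -/
theorem eq_of_images_append_eq {x y : List Choice} {c d : Choice} {P Q D D' : List (Fin 3)}
    (hc : image c = P ++ Q) (hQ : Q ≠ []) (hd : image d = D ++ D') (hD' : D' ≠ [])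
    (h : images x ++ P = images y ++ D) : x = y := by
  have aux : ∀ {c b : Choice} {P Q l : List (Fin 3)}, image c = P ++ Q → Q ≠ [] →
      P ≠ image b ++ l := by
    rintro c b P Q l hc hQ rfl
    obtain rfl := image_prefix_image b c ⟨l ++ Q, by simp [hc]⟩
    have := List.length_pos_iff.2 hQ
    have := congrArg List.length hc
    simp only [List.length_append] at this
    omega
  induction x generalizing y with
  | nil =>
    cases y with
    | nil => rfl
    | cons b y => exact absurd (by simpa using h) (aux (b := b) (l := images y ++ D) hc hQ)
  | cons a x ih =>
    cases y with
    | nil => exact absurd (by simpa using h.symm) (aux (b := a) (l := images x ++ P) hd hD')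
    | cons b y =>
      simp only [images_cons, List.append_assoc] at h
      obtain rfl : a = b := by
        rcases List.prefix_or_prefix_of_prefix (List.prefix_append (image a) (images x ++ P))
          (h ▸ List.prefix_append (image b) (images y ++ D)) with h' | h'
        · exact image_prefix_image _ _ h'
        · exact (image_prefix_image _ _ h').symm
      rw [ih (List.append_cancel_left h)]

theorem exists_choice_ne (a : Fin 3) : ∃ c : Choice, a ≠ c.1 :=
  ⟨(a + 1, false, false), by revert a; decide⟩

theorem SquareFree.fst_ne {v x y : List Choice} {a b : Choice} (hv : SquareFree (v.map Prod.fst))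
    (h : v = x ++ a :: b :: y) : a.1 ≠ b.1 := by
  intro hab
  exact hv [a.1] (by simp) ⟨x.map Prod.fst, y.map Prod.fst, by simp [h, hab]⟩

theorem not_short_square_prefix {e : Choice} {r : List Choice} {E S x : List (Fin 3)}
    (hv : SquareFree ((e :: r).map Prod.fst)) (he : image e = E ++ S) (hS : S ≠ []) (hx : x ≠ [])
    (hxl : x.length ≤ 15) : ¬ x ++ x <+: S ++ images r := by
  intro h
  obtain ⟨c, d, hec, hcd, h⟩ : ∃ c d : Choice, e.1 ≠ c.1 ∧ c.1 ≠ d.1 ∧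
      x ++ x <+: S ++ (image c ++ image d) := by
    match r, hv, h with
    | [], hv, h =>
      obtain ⟨c, hc⟩ := exists_choice_ne e.1
      obtain ⟨d, hd⟩ := exists_choice_ne c.1
      exact ⟨c, d, hc, hd, h.trans (by simp)⟩
    | [c], hv, h =>
      obtain ⟨d, hd⟩ := exists_choice_ne c.1
      exact ⟨c, d, hv.fst_ne (x := []) rfl, hd, h.trans (by simp)⟩
    | c :: d :: r, hv, h =>
      refine ⟨c, d, hv.fst_ne (x := []) rfl, hv.fst_ne (x := [e]) rfl,
        List.prefix_of_prefix_length_le h ⟨images r, by simp⟩ ?_⟩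
      have := List.length_pos_iff.2 hS
      simp only [List.length_append, length_image]
      omega
  have hlt : E.length < (image e).length := by
    have := List.length_pos_iff.2 hS
    simp only [he, List.length_append]
    omega
  have hns := no_short_square e (mem_choices e) c (mem_choices c) hec d (mem_choices d) hcd _ hlt
  rw [← code_drop, he, List.append_assoc, List.drop_left] at hns
  simp [squarePrefixCode_of_prefix hx hxl h] at hns

theorem exists_next_image {v x r : List Choice} {e c : Choice} {P Q : List (Fin 3)}
    (hv : SquareFree (v.map Prod.fst)) {s : List Choice} (h : v = s ++ e :: (x ++ c :: r))
    (hc : image c = P ++ Q) : ∃ d z, e.1 ≠ d.1 ∧ images x ++ P <+: image d ++ z := by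
  cases x with
  | nil => exact ⟨c, [], hv.fst_ne h, by simp [hc]⟩
  | cons b x => exact ⟨b, images x ++ P, hv.fst_ne h, by simp⟩

/-- Squares do not occur in the images of square-free words, except possibly at the very end. -/
theorem images_ne_append_square {v : List Choice} (hv : SquareFree (v.map Prod.fst))
    {p u s : List (Fin 3)} (hu : u ≠ []) (hs : s ≠ []) : images v ≠ p ++ (u ++ (u ++ s)) := by
  intro h
  have hu0 := List.length_pos_iff.2 hu
  obtain ⟨v₁, e, r, E, S, rfl, rfl, he, hS, h₁⟩ := exists_cut h (by simp [hu])
  have hSe : S <:+ image e := ⟨E, he.symm⟩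
  have her : SquareFree ((e :: r).map Prod.fst) :=
    hv.of_infix ⟨v₁.map Prod.fst, [], by simp⟩
  obtain hshort | hlong : u.length ≤ 15 ∨ 16 ≤ u.length := by omega
  · exact not_short_square_prefix her he hS hu hshort ⟨s, by simp [← h₁]⟩
  rcases append_eq_append_cases h₁.symm with ⟨Q, hQ, rfl, h₂⟩ | ⟨u', rfl, h₂⟩
  · rcases append_eq_append_cases h₂.symm with ⟨Q', -, rfl, -⟩ | ⟨u'', rfl, h₃⟩
    · have := congrArg List.length he
      have := length_image e
      have := Bool.toNat_le e.2.1
      have := Bool.toNat_le e.2.2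
      simp only [List.length_append] at *
      omega
    · obtain ⟨y, d, r₃, D, D', rfl, rfl, hd, hD', -⟩ := exists_cut h₃ hs
      obtain ⟨b, z, -, hb⟩ := exists_next_image hv rfl hd
      obtain ⟨f, hf⟩ := exists_choice_ne e.1
      refine not_prefix_of_boundary (z' := []) hQ (by simpa using hlong)
        ((List.suffix_append _ _).trans hSe) hb hSe ?_ hf ?_
      · simp only [List.length_append] at hu0 ⊢
        omega
      · simp [List.append_assoc]
  · obtain ⟨x, c, r₂, P, Q, rfl, rfl, hc, hQ, h₃⟩ := exists_cut h₂ (by simp [hs])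
    have hQc : Q <:+ image c := ⟨P, hc.symm⟩
    obtain ⟨b, z, hb, hb'⟩ := exists_next_image hv rfl hc
    rcases append_eq_append_cases h₃.symm with ⟨Q', hQ', rfl, -⟩ | ⟨u'', hu'', h₄⟩
    · obtain ⟨f, hf⟩ := exists_choice_ne c.1
      refine not_prefix_of_boundary (z' := []) hS (by simpa using hlong) hSe hb' hQc ?_ hf ?_
      · have := List.length_pos_iff.2 hQ'
        simp only [List.length_append]
        omega
      · simp [List.append_assoc]
    · obtain ⟨y, d, r₃, D, D', rfl, rfl, hd, hD', -⟩ := exists_cut h₄ hs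
      obtain ⟨f, z', hf, hf'⟩ := exists_next_image (s := v₁ ++ e :: x) (e := c)
        (x := y) (r := r₃) hv (by simp) hd
      rcases lt_trichotomy S.length Q.length with hlt | heq | hlt
      · refine not_prefix_of_boundary hS (by simpa using hlong) hSe hb' hQc hlt hf (z' := z') ?_
        rw [hu'', List.prefix_append_right_inj]
        exact hf'
      · obtain ⟨rfl, hxy⟩ := List.append_inj hu'' heq
        obtain rfl := eq_of_images_append_eq hc hQ hd hD' hxy
        have hec : e.1 = c.1 := by
          have h₁ := getLast?_image e
          have h₂ := getLast?_image c
          rw [he, List.getLast?_append_of_ne_nil _ hS] at h₁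
          rw [hc, List.getLast?_append_of_ne_nil _ hS, h₁] at h₂
          simpa using h₂
        refine hv (e.1 :: x.map Prod.fst) (by simp) ⟨v₁.map Prod.fst, (d :: r₃).map Prod.fst, ?_⟩
        simp [hec]
      · refine not_prefix_of_boundary hQ ?_ hQc hf' hSe hlt hb (z' := z) ?_
        · rw [hu''] at hlong
          simpa using hlong
        · rw [← hu'', List.prefix_append_right_inj]
          exact hb'

theorem circSquareFree_images {v : List Choice} (hv : CircSquareFree (v.map Prod.fst))
    (hl : 2 ≤ v.length) : CircSquareFree (images v) := by
  have hne : images v ≠ [] := by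
    match v, hl with
    | c :: v, _ => simp [image_ne_nil]
  rw [circSquareFree_iff_rotate hne]
  rintro k hk x hx ⟨t, ht⟩
  rw [List.rotate_eq_drop_append_take hk.le] at ht
  obtain ⟨v₁, e, v₂, E, S, rfl, hE, he, hS, hd⟩ :=
    exists_cut (List.take_append_drop k (images v)).symm
      (by rw [← List.length_pos_iff, List.length_drop]; omega)
  rw [hE, hd] at ht
  have hrot : CircSquareFree (e.1 :: (v₂ ++ v₁).map Prod.fst) := fun u hu => hv u <| hu.trans <| by
    simpa using List.isRotated_append (l := (e :: v₂).map Prod.fst) (l' := v₁.map Prod.fst)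
  have hsf := hrot.squareFree_concat_head (by
    rw [← List.length_pos_iff]
    simp only [List.length_append, List.length_cons, List.length_map] at hl ⊢
    omega)
  refine images_ne_append_square (v := e :: (v₂ ++ v₁) ++ [e]) (p := E) (s := t ++ S)
    (by simpa using hsf) hx (by simp [hS]) ?_
  have ht' : S ++ (images v₂ ++ (images v₁ ++ E)) = x ++ (x ++ t) := by
    simpa using ht.symm
  calc images (e :: (v₂ ++ v₁) ++ [e]) = E ++ (S ++ (images v₂ ++ (images v₁ ++ E))) ++ S := by
        simp [he]
    _ = _ := by simp [ht']

/-! ### Lengths admitting a circular square-free word -/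

theorem exists_choices (w : List (Fin 3)) {r s : ℕ} (hr : r ≤ w.length) (hs : s ≤ w.length) :
    ∃ v : List Choice, v.map Prod.fst = w ∧ (images v).length = 17 * w.length + r + 6 * s := by
  induction w generalizing r s with
  | nil => exact ⟨[], rfl, by simp_all⟩
  | cons a w ih =>
    simp only [List.length_cons] at hr hs
    obtain ⟨v, rfl, hv⟩ := ih (r := r - 1) (s := s - 1) (by omega) (by omega)
    refine ⟨(a, decide (0 < r), decide (0 < s)) :: v, rfl, ?_⟩
    simp only [images_cons, List.length_append, length_image, hv, List.length_cons]
    by_cases h₁ : 0 < r <;> by_cases h₂ : 0 < s <;> simp [h₁, h₂] <;> omega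

theorem exists_circSquareFree_mul_add {m r s : ℕ} (hm : 2 ≤ m) (hr : r ≤ m) (hs : s ≤ m)
    (h : ∃ w : List (Fin 3), w.length = m ∧ CircSquareFree w) :
    ∃ w : List (Fin 3), w.length = 17 * m + r + 6 * s ∧ CircSquareFree w := by
  obtain ⟨w, rfl, hw⟩ := h
  obtain ⟨v, rfl, hv⟩ := exists_choices w hr hs
  exact ⟨images v, hv, circSquareFree_images hw (by simpa using hm)⟩

theorem exists_circSquareFree {n : ℕ} (hn : n ∉ [5, 7, 9, 10, 14, 17]) :
    ∃ w : List (Fin 3), w.length = n ∧ CircSquareFree w := by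
  induction n using Nat.strong_induction_on with
  | _ n ih =>
  obtain hlt | hge : n < 102 ∨ 102 ≤ n := by omega
  · rcases small_lengths n hlt hn with ⟨w, hw, rfl⟩ | ⟨m, hm, r, hr, s, hs, rfl⟩
    · exact ⟨w, rfl, circSquareFree_of_mem_smallWords hw⟩
    · have hm' : m = 2 ∨ m = 3 ∨ m = 4 := by simpa using hm
      exact exists_circSquareFree_mul_add (by omega) hr hs
        (ih m (by omega) (by simp; omega))
  · obtain ⟨m, hm, hm6, hle, hle'⟩ : ∃ m, m ∉ [5, 7, 9, 10, 14, 17] ∧ 6 ≤ m ∧ 17 * m ≤ n ∧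
        n ≤ 24 * m := by
      obtain h | h | h | h | h : n ≤ 144 ∨ 136 ≤ n ∧ n ≤ 192 ∨ 187 ≤ n ∧ n ≤ 264 ∨
          255 ≤ n ∧ n ≤ 360 ∨ 306 ≤ n := by omega
      · exact ⟨6, by simp, by omega, by omega, by omega⟩
      · exact ⟨8, by simp, by omega, by omega, by omega⟩
      · exact ⟨11, by simp, by omega, by omega, by omega⟩
      · exact ⟨15, by simp, by omega, by omega, by omega⟩
      · exact ⟨n / 17, by simp; omega, by omega, by omega, by omega⟩
    have := exists_circSquareFree_mul_add (m := m) (s := min m ((n - 17 * m) / 6))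
      (r := n - 17 * m - 6 * min m ((n - 17 * m) / 6)) (by omega) (by omega) (by omega)
      (ih m (by omega) hm)
    rwa [show 17 * m + (n - 17 * m - 6 * min m ((n - 17 * m) / 6)) +
      6 * min m ((n - 17 * m) / 6) = n by omega] at this

/-- There is a square-free ternary circular word of length `n` iff `n ∉ {5,7,9,10,14,17}`. -/
theorem circular_squarefree_lengths (n : ℕ) :
    (∃ w : List (Fin 3), w.length = n ∧ CircSquareFree w) ↔
      n ∉ ({5, 7, 9, 10, 14, 17} : Set ℕ) := by
  constructor
  · rintro ⟨w, rfl, hw⟩ hn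
    have h := noExtension_exceptional w.length (by simpa using hn)
    exact not_circSquareFree_of_noExtension (w := []) (v := w) h rfl (by simp) (by simpa using hw)
  · exact fun hn => exists_circSquareFree (by simpa using hn)
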